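/- arXiv:quant-ph/0601131 — 2 statements merged into one kernel-verified Lean document; each statement's English description precedes it below -/
import Mathlib

section
/- Let H_d ∈ 𝔤 and let H₀ := ½(H_d − θ(H_d)) ∈ 𝔭 be its component in 𝔭. Assume H₀ ∈ 𝔥 and that H₀ is generic in the sense that α(1 ⊗ H₀) ≠ 0 for every root α of 𝔤_ℂ with respect to 𝔥. Then the Lie subalgebra of 𝔤 generated by 𝔨 ∪ {H_d} is all of 𝔤. (This is the Lie-algebraic content of the controllability theorem for the spin system.) -/
open scoped TensorProduct

lemma aux_subalgebra_eq_top
    {𝔤 : Type*} [LieRing 𝔤] [LieAlgebra ℝ 𝔤] [FiniteDimensional ℝ 𝔤]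
    [LieAlgebra.IsSimple ℝ 𝔤]
    (hkill : ∀ X : 𝔤, X ≠ 0 → killingForm ℝ 𝔤 X X < 0)
    (θ : 𝔤 ≃ₗ⁅ℝ⁆ 𝔤) (hθ : ∀ X : 𝔤, θ (θ X) = X)
    (S : LieSubalgebra ℝ 𝔤) (hS : ∀ X, θ X = X → X ∈ S)
    (H : 𝔤) (hH : H ∈ S) (hθH : θ H = -H) (hH0 : H ≠ 0) : S = ⊤ := by
  have hz : ∀ X : 𝔤, killingForm ℝ 𝔤 X X = 0 → X = 0 := fun X h => by
    by_contra hX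
    exact (hkill X hX).ne h
  set r := LinearMap.BilinForm.orthogonal (killingForm ℝ 𝔤) S.toSubmodule with hr
  have hmem : ∀ y, y ∈ r ↔ ∀ s ∈ S, killingForm ℝ 𝔤 s y = 0 := fun y => Iff.rfl
  have hcompl : IsCompl S.toSubmodule r := by
    rw [LinearMap.BilinForm.isCompl_orthogonal_iff_disjoint
      (LieModule.traceForm_isSymm ℝ 𝔤 𝔤).isRefl, Submodule.disjoint_def]
    intro x hx hx'
    exact hz x (hx' x hx)
  -- `r` is stable under `S`
  have hSr : ∀ s ∈ S, ∀ y ∈ r, ⁅s, y⁆ ∈ r := by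
    intro s hs y hy t ht
    have h1 := hy ⁅t, s⁆ (S.lie_mem ht hs)
    have h2 := LieModule.traceForm_apply_lie_apply ℝ 𝔤 𝔤 t s y
    exact h2.symm.trans h1
  -- `r ⊆ 𝔭`
  have hrp : ∀ y ∈ r, θ y = -y := by
    intro y hy
    have hw : θ (y + θ y) = y + θ y := by rw [map_add, hθ, add_comm]
    have h1 : killingForm ℝ 𝔤 (y + θ y) y = 0 := hy _ (hS _ hw)
    have h2 : killingForm ℝ 𝔤 (y + θ y) (θ y) = 0 := by
      have := LieAlgebra.killingForm_of_equiv_apply (R := ℝ) θ (y + θ y) y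
      rw [hw] at this
      rw [this, h1]
    have h3 : y + θ y = 0 := by
      apply hz
      rw [map_add (killingForm ℝ 𝔤 (y + θ y)), h1, h2, add_zero]
    exact (neg_eq_of_add_eq_zero_right h3).symm
  let C : LieIdeal ℝ 𝔤 :=
    { carrier := {x | ∀ y ∈ r, ⁅x, y⁆ = 0}
      add_mem' := by
        intro a b ha hb y hy
        rw [add_lie, ha y hy, hb y hy, add_zero]
      zero_mem' := by
        intro y hy
        exact zero_lie y
      smul_mem' := by
        intro c x hx y hy
        rw [smul_lie, hx y hy, smul_zero]
      lie_mem := by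
        intro g x hx y hy
        have hx' : ∀ y ∈ r, ⁅x, y⁆ = 0 := hx
        obtain ⟨s, hs, z, hz, rfl⟩ :=
          Submodule.mem_sup.mp (hcompl.sup_eq_top ▸ Submodule.mem_top : g ∈ S.toSubmodule ⊔ r)
        have h0 : ⁅z, x⁆ = 0 := by rw [← lie_skew, hx' z hz, neg_zero]
        rw [add_lie, h0, add_zero, lie_lie, hx' y hy, hx' _ (hSr s hs y hy), lie_zero, sub_zero] }
  have hHC : H ∈ C := by
    intro y hy
    have h1 := hrp _ (hSr H hH y hy)
    rw [LieEquiv.map_lie, hθH, hrp y hy, neg_lie, lie_neg, neg_neg] at h1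
    have h2 : (2 : ℝ) • ⁅H, y⁆ = 0 := by rw [two_smul]; nth_rewrite 1 [h1]; exact neg_add_cancel _
    exact (smul_eq_zero.mp h2).resolve_left two_ne_zero
  have hC : C = ⊤ := by
    refine (LieAlgebra.IsSimple.eq_bot_or_eq_top C).resolve_left ?_
    intro h
    rw [h] at hHC
    exact hH0 ((LieSubmodule.mem_bot H).mp hHC)
  have hr0 : r = ⊥ := by
    rw [Submodule.eq_bot_iff]
    intro y hy
    apply hz
    have h0 : LieAlgebra.ad ℝ 𝔤 y = 0 := by
      ext x
      have hx : x ∈ C := hC ▸ LieSubmodule.mem_top x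
      have : ⁅x, y⁆ = 0 := hx y hy
      rw [LieAlgebra.ad_apply, ← lie_skew, this, neg_zero, LinearMap.zero_apply]
    rw [killingForm_apply_apply, h0]
    simp
  have h1 := hcompl.sup_eq_top
  rw [hr0, sup_bot_eq] at h1
  rw [← LieSubalgebra.toSubmodule_inj, h1]
  rfl

lemma aux_exists_root
    {𝔤 : Type*} [LieRing 𝔤] [LieAlgebra ℝ 𝔤] [FiniteDimensional ℝ 𝔤]
    (𝔥 : LieSubalgebra ℝ 𝔤) (hab : IsLieAbelian 𝔥) (Y : 𝔥)
    (hY : killingForm ℝ 𝔤 (Y : 𝔤) (Y : 𝔤) ≠ 0) :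
    ∃ α : (ℂ ⊗[ℝ] 𝔥) →ₗ[ℂ] ℂ, α ≠ 0 ∧
      (∃ X : ℂ ⊗[ℝ] 𝔤, X ≠ 0 ∧ ∀ Y : ℂ ⊗[ℝ] 𝔥,
        ⁅LinearMap.baseChange ℂ (𝔥.incl : 𝔥 →ₗ⁅ℝ⁆ 𝔤).toLinearMap Y, X⁆ = α Y • X) := by
  have hnil : LieRing.IsNilpotent (ℂ ⊗[ℝ] 𝔥) :=
    inferInstanceAs (LieModule.IsNilpotent (ℂ ⊗[ℝ] 𝔥) (ℂ ⊗[ℝ] 𝔥))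
  by_contra hcon
  have hzero : ∀ χ : LieModule.Weight ℂ (ℂ ⊗[ℝ] 𝔥) (ℂ ⊗[ℝ] 𝔤), ∀ x, χ x = 0 := by
    intro χ x
    by_contra hx
    apply hcon
    obtain ⟨m, hm0, hm⟩ := LieModule.exists_forall_lie_eq_smul ℂ (ℂ ⊗[ℝ] 𝔥) (ℂ ⊗[ℝ] 𝔤) χ
    refine ⟨LieModule.Weight.toLinear ℂ (ℂ ⊗[ℝ] 𝔥) (ℂ ⊗[ℝ] 𝔤) χ, ?_, m, hm0, fun Z => ?_⟩
    · intro h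
      exact hx (by simpa using LinearMap.congr_fun h x)
    · rw [LieModule.Weight.toLinear_apply, ← hm Z]
      clear hm hm0
      induction Z with
      | zero => simp
      | add a b ha hb => rw [map_add, add_lie, add_lie, ha, hb]
      | tmul a x =>
        induction m with
        | zero => simp
        | add p q hp hq => rw [lie_add, lie_add, hp, hq]
        | tmul b y => rfl
  have h1 := LieModule.traceForm_eq_sum_finrank_nsmul_mul ℂ (ℂ ⊗[ℝ] 𝔥) (ℂ ⊗[ℝ] 𝔤)
    ((1 : ℂ) ⊗ₜ[ℝ] Y) ((1 : ℂ) ⊗ₜ[ℝ] Y)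
  rw [Finset.sum_eq_zero (fun χ _ => by rw [hzero χ, zero_mul, smul_zero]),
    LieModule.traceForm_baseChange] at h1
  have h2 : LieModule.traceForm ℝ 𝔥 𝔤 Y Y = 0 := by
    simpa using h1
  exact hY h2

/-- **Controllability: the Lie algebra generated by `𝔨` and `H_d` is all of `𝔤`.**
Let `𝔤` be a simple real Lie algebra of compact type (negative definite Killing form),
`θ` an involutive automorphism with `1`-eigenspace `𝔨` and `(−1)`-eigenspace `𝔭`,
and `𝔥 ⊆ 𝔭` maximal abelian in `𝔭`.  Let `H_d ∈ 𝔤` with `𝔭`-component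
`H₀ = ½(H_d − θH_d) ∈ 𝔥`, and assume `H₀` is generic: `α(1 ⊗ H₀) ≠ 0` for every root `α`
of `𝔤_ℂ = ℂ ⊗ 𝔤` with respect to `𝔥` (a root being a nonzero linear functional on
`ℂ ⊗ 𝔥` whose weight space is nonzero).  Then the Lie subalgebra of `𝔤` generated by
`𝔨 ∪ {H_d}` equals `𝔤`. -/
theorem controllability_lie_span
    {𝔤 : Type*} [LieRing 𝔤] [LieAlgebra ℝ 𝔤] [FiniteDimensional ℝ 𝔤]
    [LieAlgebra.IsSimple ℝ 𝔤]
    (hkill : ∀ X : 𝔤, X ≠ 0 → killingForm ℝ 𝔤 X X < 0)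
    (θ : 𝔤 ≃ₗ⁅ℝ⁆ 𝔤) (hθ : ∀ X : 𝔤, θ (θ X) = X)
    (𝔥 : LieSubalgebra ℝ 𝔤) (hab : IsLieAbelian 𝔥)
    (h𝔥𝔭 : ∀ X ∈ 𝔥, θ X = -X)
    (hmax : ∀ 𝔥' : LieSubalgebra ℝ 𝔤, IsLieAbelian 𝔥' → (∀ X ∈ 𝔥', θ X = -X) →
      𝔥 ≤ 𝔥' → 𝔥' = 𝔥)
    (Hd H₀ : 𝔤) (hH₀ : H₀ = (2⁻¹ : ℝ) • (Hd - θ Hd)) (hH₀𝔥 : H₀ ∈ 𝔥)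
    (hgeneric : ∀ α : (ℂ ⊗[ℝ] 𝔥) →ₗ[ℂ] ℂ, α ≠ 0 →
      (∃ X : ℂ ⊗[ℝ] 𝔤, X ≠ 0 ∧ ∀ Y : ℂ ⊗[ℝ] 𝔥,
        ⁅LinearMap.baseChange ℂ (𝔥.incl : 𝔥 →ₗ⁅ℝ⁆ 𝔤).toLinearMap Y, X⁆ = α Y • X) →
      α ((1 : ℂ) ⊗ₜ[ℝ] (⟨H₀, hH₀𝔥⟩ : 𝔥)) ≠ 0) :
    LieSubalgebra.lieSpan ℝ 𝔤 ({X : 𝔤 | θ X = X} ∪ {Hd}) = ⊤ := by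
  have hθH : θ H₀ = -H₀ := h𝔥𝔭 H₀ hH₀𝔥
  set S := LieSubalgebra.lieSpan ℝ 𝔤 ({X : 𝔤 | θ X = X} ∪ {Hd}) with hSdef
  have hS : ∀ X, θ X = X → X ∈ S := fun X hX =>
    LieSubalgebra.subset_lieSpan (Or.inl hX)
  have hHd : Hd ∈ S := LieSubalgebra.subset_lieSpan (Or.inr rfl)
  have hK : Hd - H₀ ∈ S := by
    apply hS
    rw [hH₀, map_sub, map_smul, map_sub, hθ]
    module
  have hH : H₀ ∈ S := by
    have := S.sub_mem hHd hK
    rwa [sub_sub_cancel] at this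
  by_cases h0 : H₀ = 0
  · -- no roots, so `𝔥 = 0`, so `𝔭 = 0`
    have hbot : ∀ X ∈ 𝔥, X = 0 := by
      intro X hX
      by_contra hX0
      obtain ⟨α, hα, hα'⟩ := aux_exists_root 𝔥 hab ⟨X, hX⟩ (hkill X hX0).ne
      apply hgeneric α hα hα'
      have : (⟨H₀, hH₀𝔥⟩ : 𝔥) = 0 := Subtype.ext h0
      rw [this, TensorProduct.tmul_zero, map_zero]
    have hp : ∀ X : 𝔤, θ X = -X → X = 0 := by
      intro X hX
      let L : LieSubalgebra ℝ 𝔤 :=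
        { Submodule.span ℝ {X} with
          lie_mem' := by
            intro a b ha hb
            obtain ⟨s, rfl⟩ := Submodule.mem_span_singleton.mp ha
            obtain ⟨t, rfl⟩ := Submodule.mem_span_singleton.mp hb
            simp }
      have hXL : X ∈ L := Submodule.mem_span_singleton_self X
      have hL : L = 𝔥 := by
        apply hmax
        · refine ⟨fun a b => Subtype.ext ?_⟩
          obtain ⟨s, hs⟩ := Submodule.mem_span_singleton.mp a.2
          obtain ⟨t, ht⟩ := Submodule.mem_span_singleton.mp b.2
          rw [LieSubalgebra.coe_bracket, ← hs, ← ht]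
          simp
        · intro a ha
          obtain ⟨s, rfl⟩ := Submodule.mem_span_singleton.mp ha
          rw [map_smul, hX, smul_neg]
        · intro a ha
          rw [hbot a ha]
          exact L.zero_mem
      exact hbot X (hL ▸ hXL)
    rw [eq_top_iff]
    intro X _
    apply hS
    have := hp (X - θ X) (by rw [map_sub, hθ, neg_sub])
    exact (sub_eq_zero.mp this).symm
  · exact aux_subalgebra_eq_top hkill θ hθ S hS H₀ hH hθH h0
end

section
/- There exists an involutive real Lie algebra automorphism θ of su(2^n) (i.e. θ ∘ θ = id) whose fixed-point subalgebra { X : θ(X) = X } is exactly 𝔨_n if and only if n ≤ 2. In other words, the pair (su(2^n), su(2)^{⊗n}) is a symmetric Lie algebra pair precisely when n ≤ 2. -/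
open Matrix Complex

/-- The four basic `2 × 2` matrices: the identity and the Pauli-type matrices
`I_x = [[0,1],[−1,0]]`, `I_y = [[0,i],[i,0]]`, `I_z = [[i,0],[0,−i]]`. -/
def pauliMat : Fin 4 → Matrix (Fin 2) (Fin 2) ℂ
  | 0 => 1
  | 1 => !![0, 1; -1, 0]
  | 2 => !![0, I; I, 0]
  | 3 => !![I, 0; 0, -I]

/-- The `n`-fold Kronecker (tensor) product `A₁ ⊗ A₂ ⊗ ⋯ ⊗ A_n` of the `2 × 2` matrices
selected by `f : Fin n → Fin 4`, realized as a matrix indexed by `Fin n → Fin 2`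
(a canonical model of a `2^n × 2^n` matrix). -/
noncomputable def tensorPauli (n : ℕ) (f : Fin n → Fin 4) :
    Matrix (Fin n → Fin 2) (Fin n → Fin 2) ℂ :=
  Matrix.of fun i j => ∏ k : Fin n, pauliMat (f k) (i k) (j k)

/-- The set `X_j` of all matrices `i^{ε_j}·A₁⊗⋯⊗A_n`, with each `A_k ∈ {1, I_x, I_y, I_z}`,
exactly `j` factors different from the identity, and `ε_j = 1` for `j` even, `ε_j = 0`
for `j` odd. -/
noncomputable def tensorSet (n j : ℕ) : Set (Matrix (Fin n → Fin 2) (Fin n → Fin 2) ℂ) :=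
  {A | ∃ f : Fin n → Fin 4,
    (Finset.univ.filter fun k : Fin n => f k ≠ 0).card = j ∧
    A = (if Even j then I else 1) • tensorPauli n f}

/-- `su(2^n)`: the traceless skew-Hermitian complex matrices (indexed by `Fin n → Fin 2`). -/
def suSet (n : ℕ) : Set (Matrix (Fin n → Fin 2) (Fin n → Fin 2) ℂ) :=
  {A | Aᴴ = -A ∧ A.trace = 0}

/-- The subalgebra `𝔨_n = su(2)^{⊗n}`, the real span of `X₁` (the tensor products with
exactly one non-identity factor). -/
noncomputable def kN (n : ℕ) : Submodule ℝ (Matrix (Fin n → Fin 2) (Fin n → Fin 2) ℂ) :=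
  Submodule.span ℝ (tensorSet n 1)

namespace SymPair

abbrev M2 := Matrix (Fin 2) (Fin 2) ℂ
abbrev MN (n : ℕ) := Matrix (Fin n → Fin 2) (Fin n → Fin 2) ℂ

/-- Tensor product of a family of `2 × 2` matrices. -/
noncomputable def tens {n : ℕ} (A : Fin n → M2) : MN n :=
  Matrix.of fun i j => ∏ k : Fin n, A k (i k) (j k)

lemma tens_mul {n : ℕ} (A B : Fin n → M2) : tens A * tens B = tens (fun k => A k * B k) := by
  ext i j
  simp only [tens, Matrix.mul_apply, Matrix.of_apply]
  rw [Finset.prod_univ_sum]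
  simp [Finset.prod_mul_distrib]

lemma tens_one {n : ℕ} : tens (fun _ : Fin n => (1 : M2)) = 1 := by
  ext i j
  simp only [tens, Matrix.of_apply, Matrix.one_apply]
  by_cases h : i = j
  · subst h; simp
  · rw [if_neg h]
    obtain ⟨k, hk⟩ := Function.ne_iff.mp h
    exact Finset.prod_eq_zero (Finset.mem_univ k) (by simp [hk])

lemma tens_conj {n : ℕ} (A : Fin n → M2) : (tens A)ᴴ = tens (fun k => (A k)ᴴ) := by
  ext i j
  simp [tens, Matrix.conjTranspose_apply]

lemma tens_transpose {n : ℕ} (A : Fin n → M2) : (tens A)ᵀ = tens (fun k => (A k)ᵀ) := by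
  ext i j
  simp [tens]

lemma tens_trace {n : ℕ} (A : Fin n → M2) : (tens A).trace = ∏ k, (A k).trace := by
  simp only [tens, Matrix.trace, Matrix.diag, Matrix.of_apply]
  rw [Finset.prod_univ_sum]
  simp

/-- Embedding of a `2 × 2` matrix at one site. -/
noncomputable def E {n : ℕ} (a : Fin n) (A : M2) : MN n :=
  tens (Function.update (fun _ => 1) a A)

lemma E_mul {n : ℕ} (a : Fin n) (A B : M2) : E a A * E a B = E a (A * B) := by
  rw [E, E, E, tens_mul]
  congr 1
  funext k
  by_cases h : k = a
  · subst h; simp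
  · simp [h]

lemma E_comm {n : ℕ} {a b : Fin n} (hab : a ≠ b) (A B : M2) : E a A * E b B = E b B * E a A := by
  rw [E, E, tens_mul, tens_mul]
  congr 1
  funext k
  by_cases h : k = a
  · subst h; simp [hab]
  · by_cases h' : k = b
    · subst h'; simp [h]
    · simp [h, h']

lemma E_apply {n : ℕ} (a : Fin n) (A : M2) (i j : Fin n → Fin 2) :
    E a A i j = A (i a) (j a) * ∏ k ∈ Finset.univ.erase a, (1 : M2) (i k) (j k) := by
  simp only [E, tens, Matrix.of_apply]
  rw [← Finset.mul_prod_erase _ _ (Finset.mem_univ a)]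
  simp only [Function.update_self]
  congr 1
  apply Finset.prod_congr rfl
  intro k hk
  simp [Finset.ne_of_mem_erase hk]

lemma E_sub {n : ℕ} (a : Fin n) (A B : M2) : E a (A - B) = E a A - E a B := by
  ext i j
  simp [E_apply, sub_mul]

lemma E_smul {n : ℕ} (a : Fin n) (c : ℂ) (A : M2) : E a (c • A) = c • E a A := by
  ext i j
  simp [E_apply, mul_assoc]

lemma E_neg {n : ℕ} (a : Fin n) (A : M2) : E a (-A) = - E a A := by
  ext i j
  simp [E_apply]

lemma E_one {n : ℕ} (a : Fin n) : E a 1 = 1 := by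
  rw [E, ← tens_one]; congr 1; exact Function.update_eq_self a _

lemma E_conj {n : ℕ} (a : Fin n) (A : M2) : (E a A)ᴴ = E a Aᴴ := by
  rw [E, E, tens_conj]; congr 1; funext k
  by_cases h : k = a
  · subst h; simp
  · simp [h]

lemma E_trace {n : ℕ} (a : Fin n) (A : M2) (h : A.trace = 0) : (E a A).trace = 0 := by
  rw [E, tens_trace]
  exact Finset.prod_eq_zero (Finset.mem_univ a) (by simp [h])

lemma E_trace2 {n : ℕ} {a b : Fin n} (hab : a ≠ b) (A B : M2) (h : A.trace = 0) :
    (E a A * E b B).trace = 0 := by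
  rw [E, E, tens_mul, tens_trace]
  exact Finset.prod_eq_zero (Finset.mem_univ a) (by simp [h, hab])

abbrev x : M2 := pauliMat 1
abbrev y : M2 := pauliMat 2
abbrev z : M2 := pauliMat 3

lemma pauli_trace (p : Fin 4) (hp : p ≠ 0) : (pauliMat p).trace = 0 := by
  fin_cases p <;> simp_all [pauliMat, Matrix.trace_fin_two]

lemma pauli_conj (p : Fin 4) (hp : p ≠ 0) : (pauliMat p)ᴴ = - pauliMat p := by
  fin_cases p
  · exact absurd rfl hp
  all_goals
    ext i j
    fin_cases i <;> fin_cases j <;> simp [pauliMat, Matrix.conjTranspose_apply]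

lemma tensorSet_one {n : ℕ} (W : MN n) :
    W ∈ tensorSet n 1 ↔ ∃ (a : Fin n) (p : Fin 4), p ≠ 0 ∧ W = E a (pauliMat p) := by
  constructor
  · rintro ⟨f, hf, rfl⟩
    obtain ⟨a, ha⟩ := Finset.card_eq_one.mp hf
    have key : ∀ k, f k ≠ 0 ↔ k = a := fun k => by
      have := Finset.ext_iff.mp ha k
      simpa using this
    refine ⟨a, f a, (key a).mpr rfl, ?_⟩
    have : ¬ Even 1 := by decide
    rw [if_neg this, one_smul]
    change tens (fun k => pauliMat (f k)) = _
    rw [E]; congr 1; funext k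
    by_cases h : k = a
    · subst h; simp
    · have : f k = 0 := by
        by_contra h'
        exact h ((key k).mp h')
      simp [h, this, pauliMat]
  · rintro ⟨a, p, hp, rfl⟩
    refine ⟨Function.update (fun _ => 0) a p, ?_, ?_⟩
    · rw [Finset.card_eq_one]
      refine ⟨a, ?_⟩
      ext k
      by_cases h : k = a
      · subst h; simp [hp]
      · simp [h]
    · have : ¬ Even 1 := by decide
      rw [if_neg this, one_smul]
      change _ = tens (fun k => pauliMat (Function.update (fun _ => (0 : Fin 4)) a p k))
      rw [E]; congr 1; funext k
      by_cases h : k = a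
      · subst h; simp
      · simp [h, pauliMat]

lemma E_mem {n : ℕ} (a : Fin n) (p : Fin 4) (hp : p ≠ 0) : E a (pauliMat p) ∈ kN n :=
  Submodule.subset_span ((tensorSet_one _).mpr ⟨a, p, hp, rfl⟩)

lemma suSet_lin {n : ℕ} {X Y : MN n} (hX : X ∈ suSet n) (hY : Y ∈ suSet n) (a b : ℝ) :
    a • X + b • Y ∈ suSet n := by
  obtain ⟨h1, h2⟩ := hX
  obtain ⟨h3, h4⟩ := hY
  constructor
  · rw [Matrix.conjTranspose_add, Matrix.conjTranspose_smul, Matrix.conjTranspose_smul, h1, h3]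
    simp [add_comm]
  · simp [h2, h4]

lemma suSet_br {n : ℕ} {X Y : MN n} (hX : X ∈ suSet n) (hY : Y ∈ suSet n) :
    X * Y - Y * X ∈ suSet n := by
  obtain ⟨h1, h2⟩ := hX
  obtain ⟨h3, h4⟩ := hY
  constructor
  · rw [Matrix.conjTranspose_sub, Matrix.conjTranspose_mul, Matrix.conjTranspose_mul, h1, h3]
    simp
  · rw [Matrix.trace_sub, Matrix.trace_mul_comm, sub_self]

lemma kN_su {n : ℕ} {W : MN n} (hW : W ∈ kN n) : W ∈ suSet n := by
  induction hW using Submodule.span_induction with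
  | mem W hW =>
    obtain ⟨a, p, hp, rfl⟩ := (tensorSet_one _).mp hW
    exact ⟨by rw [E_conj, pauli_conj p hp, E_neg], E_trace _ _ (pauli_trace p hp)⟩
  | zero => exact ⟨by simp, by simp⟩
  | add X Y _ _ hX hY => simpa using suSet_lin hX hY 1 1
  | smul c X _ hX => simpa using suSet_lin hX hX c 0

lemma kN_kill {n : ℕ} {a b : Fin n} (hab : a ≠ b) (C D : M2) {W : MN n} (hW : W ∈ kN n) :
    E a C * (E b D * W - W * E b D) - (E b D * W - W * E b D) * E a C = 0 := by
  induction hW using Submodule.span_induction with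
  | mem W hW =>
    obtain ⟨c, p, hp, rfl⟩ := (tensorSet_one _).mp hW
    by_cases h : c = b
    · subst h
      rw [E_mul, E_mul, ← E_sub, E_comm hab, sub_self]
    · rw [E_comm h]; simp
  | zero => simp
  | add X Y _ _ hX hY =>
    have := congrArg₂ (· + ·) hX hY
    simp only [add_zero] at this
    rw [← this]; noncomm_ring
  | smul c X _ hX =>
    have := congrArg (c • ·) hX
    simp only [smul_zero] at this
    rw [← this]
    simp only [smul_sub, mul_sub, sub_mul, Matrix.mul_smul, Matrix.smul_mul]

lemma Y_su {n : ℕ} {a b : Fin n} (hab : a ≠ b) (p q : Fin 4) (hp : p ≠ 0) (hq : q ≠ 0) :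
    I • (E a (pauliMat p) * E b (pauliMat q)) ∈ suSet n := by
  constructor
  · rw [Matrix.conjTranspose_smul, Matrix.conjTranspose_mul, E_conj, E_conj, pauli_conj p hp,
      pauli_conj q hq, E_neg, E_neg, neg_mul_neg, E_comm hab]
    simp
  · rw [Matrix.trace_smul, E_trace2 hab _ _ (pauli_trace p hp), smul_zero]

/-- double commutator of a two-site element -/
lemma dbl {n : ℕ} {a b : Fin n} (hab : a ≠ b) (C D A B : M2) :
    E a C * (E b D * (I • (E a A * E b B)) - (I • (E a A * E b B)) * E b D)
      - (E b D * (I • (E a A * E b B)) - (I • (E a A * E b B)) * E b D) * E a C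
    = I • (E a (C * A - A * C) * E b (D * B - B * D)) := by
  have h1 : E b D * (E a A * E b B) = E a A * E b (D * B) := by
    rw [← mul_assoc, ← E_comm hab, mul_assoc, E_mul]
  have h2 : (E a A * E b B) * E b D = E a A * E b (B * D) := by
    rw [mul_assoc, E_mul]
  rw [Matrix.mul_smul, Matrix.smul_mul, h1, h2, ← smul_sub, ← mul_sub, ← E_sub, Matrix.mul_smul,
    Matrix.smul_mul, ← smul_sub, ← mul_assoc, E_mul, mul_assoc, ← E_comm hab, ← mul_assoc, E_mul,
    ← sub_mul, ← E_sub]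

lemma xy : x * y - y * x = (2 : ℂ) • z := by
  ext i j; fin_cases i <;> fin_cases j <;> simp [pauliMat] <;> ring
lemma zx : z * x - x * z = (2 : ℂ) • y := by
  ext i j; fin_cases i <;> fin_cases j <;> simp [pauliMat] <;> ring
lemma zy : z * y - y * z = (-2 : ℂ) • x := by
  ext i j; fin_cases i <;> fin_cases j <;> simp [pauliMat] <;> ring
lemma xz : x * z - z * x = (-2 : ℂ) • y := by
  ext i j; fin_cases i <;> fin_cases j <;> simp [pauliMat] <;> ring
lemma yy : y * y = -1 := by
  ext i j; fin_cases i <;> fin_cases j <;> simp [pauliMat]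
lemma zz : z * z = -1 := by
  ext i j; fin_cases i <;> fin_cases j <;> simp [pauliMat]

lemma no_theta {n : ℕ} (hn : 3 ≤ n) (θ : MN n → MN n)
    (h1 : Set.MapsTo θ (suSet n) (suSet n))
    (h2 : ∀ X ∈ suSet n, ∀ Y ∈ suSet n, ∀ a b : ℝ, θ (a • X + b • Y) = a • θ X + b • θ Y)
    (h3 : ∀ X ∈ suSet n, θ (θ X) = X)
    (h4 : ∀ X ∈ suSet n, ∀ Y ∈ suSet n, θ (X * Y - Y * X) = θ X * θ Y - θ Y * θ X)
    (h5 : {X | X ∈ suSet n ∧ θ X = X} = (kN n : Set _)) : False := by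
  have fix : ∀ X, X ∈ kN n ↔ X ∈ suSet n ∧ θ X = X := fun X => by
    have := Set.ext_iff.mp h5 X
    simpa using this.symm
  have key : ∀ (a b : Fin n) (_ : a ≠ b) (r s p q : Fin 4) (_ : r ≠ 0) (_ : s ≠ 0) (_ : p ≠ 0)
      (_ : q ≠ 0) (Z : MN n), Z = I • (E a (pauliMat r * pauliMat p - pauliMat p * pauliMat r) *
        E b (pauliMat s * pauliMat q - pauliMat q * pauliMat s)) → Z ∈ suSet n ∧ θ Z = -Z := by
    intro a b hab r s p q hr hs hp hq Z hZ
    have hY := Y_su hab p q hp hq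
    rw [← dbl hab] at hZ
    set Y := I • (E a (pauliMat p) * E b (pauliMat q))
    obtain ⟨hC, hC'⟩ := (fix _).mp (E_mem a r hr)
    obtain ⟨hD, hD'⟩ := (fix _).mp (E_mem b s hs)
    have hDY := suSet_br hD hY
    refine ⟨hZ ▸ suSet_br hC hDY, ?_⟩
    have hk : Y + θ Y ∈ kN n := by
      rw [fix]
      have e := h2 Y hY _ (h1 hY) 1 1
      have e' := suSet_lin hY (h1 hY) 1 1
      rw [h3 Y hY] at e
      simp only [one_smul] at e e'
      exact ⟨e', by rw [e, add_comm]⟩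
    have := kN_kill hab (pauliMat r) (pauliMat s) hk
    rw [hZ, h4 _ hC _ hDY, h4 _ hD _ hY, hC', hD', eq_neg_iff_add_eq_zero, ← this]
    noncomm_ring
  let a : Fin n := ⟨0, by omega⟩
  let b : Fin n := ⟨1, by omega⟩
  let c : Fin n := ⟨2, by omega⟩
  have hab : a ≠ b := by simp [a, b]
  have hac : a ≠ c := by simp [a, c]
  have hbc : b ≠ c := by simp [b, c]
  obtain ⟨s1, t1⟩ := key a b hab 3 3 1 1 (by decide) (by decide) (by decide) (by decide) _ rfl
  obtain ⟨s2, t2⟩ := key b c hbc 3 3 2 1 (by decide) (by decide) (by decide) (by decide) _ rfl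
  rw [zx] at s1 t1
  rw [zx, zy] at s2 t2
  have hW := h4 _ s1 _ s2
  rw [t1, t2, neg_mul_neg, neg_mul_neg] at hW
  have hWk := (fix _).mpr ⟨suSet_br s1 s2, hW⟩
  have hz := kN_kill hab x x hWk
  simp only [E_smul, Matrix.smul_mul, Matrix.mul_smul] at hz
  have e1 : E a y * E b y * (E b x * E c y) = E a y * E b (y * x) * E c y := by
    rw [← E_mul]; simp only [mul_assoc]
  have e2 : E b x * E c y * (E a y * E b y) = E a y * E b (x * y) * E c y := by
    rw [← E_mul]
    calc E b x * E c y * (E a y * E b y) = E b x * (E c y * E a y) * E b y := by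
          simp only [mul_assoc]
      _ = E b x * E a y * (E c y * E b y) := by rw [← E_comm hac]; simp only [mul_assoc]
      _ = _ := by rw [← E_comm hbc, ← E_comm hab]; simp only [mul_assoc]
  have e3 : E a y * E b y * (E b x * E c y) - E b x * E c y * (E a y * E b y)
      = (-2 : ℂ) • (E a y * E b z * E c y) := by
    rw [e1, e2, ← sub_mul, ← mul_sub, ← E_sub, ← neg_sub (x * y), xy, E_neg, E_smul]
    simp
  have e4 : E b x * (E a y * E b z * E c y) - (E a y * E b z * E c y) * E b x
      = (-2 : ℂ) • (E a y * E b y * E c y) := by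
    have f1 : E b x * (E a y * E b z * E c y) = E a y * E b (x * z) * E c y := by
      rw [← E_mul, ← mul_assoc, ← mul_assoc, ← E_comm hab]; simp only [mul_assoc]
    have f2 : (E a y * E b z * E c y) * E b x = E a y * E b (z * x) * E c y := by
      rw [← E_mul, mul_assoc, ← E_comm hbc]; simp only [mul_assoc]
    rw [f1, f2, ← sub_mul, ← mul_sub, ← E_sub, xz, E_smul]
    simp
  have e5 : E a x * (E a y * E b y * E c y) - (E a y * E b y * E c y) * E a x
      = (2 : ℂ) • (E a z * E b y * E c y) := by
    have f1 : E a x * (E a y * E b y * E c y) = E a (x * y) * E b y * E c y := by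
      rw [← E_mul]; simp only [mul_assoc]
    have f2 : (E a y * E b y * E c y) * E a x = E a (y * x) * E b y * E c y := by
      rw [← E_mul, mul_assoc, ← E_comm hac, mul_assoc, ← mul_assoc (E b y), ← E_comm hab]
      simp only [mul_assoc]
    rw [f1, f2, ← sub_mul, ← sub_mul, ← E_sub, xy, E_smul]
    simp
  have hz2 : E a x * (E b x * (E a y * E b y * (E b x * E c y) - E b x * E c y * (E a y * E b y))
      - (E a y * E b y * (E b x * E c y) - E b x * E c y * (E a y * E b y)) * E b x)
      - (E b x * (E a y * E b y * (E b x * E c y) - E b x * E c y * (E a y * E b y))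
      - (E a y * E b y * (E b x * E c y) - E b x * E c y * (E a y * E b y)) * E b x) * E a x
      = 0 := by
    simp only [← smul_sub, smul_comm (_ : ℂ) (_ : ℂ), Matrix.smul_mul, Matrix.mul_smul] at hz
    simpa using hz
  rw [e3, Matrix.mul_smul, Matrix.smul_mul, ← smul_sub, e4, Matrix.mul_smul, Matrix.smul_mul,
    Matrix.mul_smul, Matrix.smul_mul, ← smul_sub, ← smul_sub, e5] at hz2
  have hz3 : E a z * E b y * E c y = 0 := by simpa using hz2
  have e6 : E a z * (E b y * (E a z * E b y * E c y) * E c y) = -1 := by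
    have g1 : E b y * (E a z * E b y * E c y) * E c y = E a z := by
      rw [← mul_assoc, ← mul_assoc, ← E_comm hab, mul_assoc (E a z), E_mul, mul_assoc, E_mul, yy,
        E_neg, E_neg, E_one, E_one]
      simp
    rw [g1, E_mul, zz, E_neg, E_one]
  rw [hz3] at e6
  simp at e6

lemma case_one {X : MN 1} (hX : X ∈ suSet 1) : X ∈ kN 1 := by
  obtain ⟨h, ht⟩ := hX
  have key : X = (X ![0] ![1]).re • E 0 x + (X ![0] ![1]).im • E 0 y
      + (X ![0] ![0]).im • E 0 z := by
    have hh : ∀ i j, star (X j i) = - X i j := fun i j => by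
      have := congrFun (congrFun h i) j
      simpa [Matrix.conjTranspose_apply] using this
    have ht' : X ![0] ![0] + X ![1] ![1] = 0 := by
      rw [← ht, Matrix.trace, ← (Equiv.funUnique (Fin 1) (Fin 2)).symm.sum_comp,
        Fin.sum_univ_two]
      congr 2 <;> ext i <;> fin_cases i <;> rfl
    have a1 := hh ![0] ![0]
    have a2 := hh ![0] ![1]
    simp only [Complex.ext_iff, Complex.star_def, Complex.conj_re, Complex.conj_im, Complex.neg_re,
      Complex.neg_im, Complex.add_re, Complex.add_im, Complex.zero_re, Complex.zero_im]
      at a1 a2 ht'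
    ext i j
    have hi : i = ![i 0] := by ext k; fin_cases k; rfl
    have hj : j = ![j 0] := by ext k; fin_cases k; rfl
    rw [hi, hj]
    generalize i 0 = i0
    generalize j 0 = j0
    fin_cases i0 <;> fin_cases j0 <;> apply Complex.ext <;>
      simp [E, tens, pauliMat] <;> linarith
  rw [key]
  exact add_mem (add_mem (Submodule.smul_mem _ _ (E_mem _ _ (by decide)))
    (Submodule.smul_mem _ _ (E_mem _ _ (by decide)))) (Submodule.smul_mem _ _ (E_mem _ _ (by decide)))

noncomputable def JM : MN 2 := tens (fun _ => x)

lemma JJ : JM * JM = 1 := by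
  have : x * x = -1 := by
    ext i j; fin_cases i <;> fin_cases j <;> simp [pauliMat]
  rw [JM, tens_mul, this, ← tens_one]
  ext i j
  simp [tens]

lemma Jt : JMᵀ = JM := by
  have : xᵀ = -x := by
    ext i j; fin_cases i <;> fin_cases j <;> simp [pauliMat]
  rw [JM, tens_transpose, this]
  ext i j
  simp [tens]

lemma Jh : JMᴴ = JM := by
  rw [JM, tens_conj, pauli_conj 1 (by decide)]
  ext i j
  simp [tens]

noncomputable def th (X : MN 2) : MN 2 := - (JM * Xᵀ * JM)

lemma th_E (a : Fin 2) (p : Fin 4) (hp : p ≠ 0) : th (E a (pauliMat p)) = E a (pauliMat p) := by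
  have h0 : x * x = -1 := by
    ext i j; fin_cases i <;> fin_cases j <;> simp [pauliMat]
  have h : x * (pauliMat p)ᵀ * x = pauliMat p := by
    clear h0
    ext i j
    simp only [Matrix.mul_apply, Fin.sum_univ_two, Matrix.transpose_apply]
    fin_cases p <;> fin_cases i <;> fin_cases j <;> simp_all [pauliMat]
  have : th (E a (pauliMat p)) = - tens (Function.update (fun _ => -1) a (pauliMat p)) := by
    rw [th, JM, E, tens_transpose, tens_mul, tens_mul]
    congr 2; funext k
    by_cases hk : k = a
    · subst hk; simp [h]
    · simp [hk, h0]
  rw [this]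
  ext i j
  fin_cases a <;> simp [E, tens, Function.update]

lemma E0_apply (A : M2) (i j : Fin 2 → Fin 2) :
    E 0 A i j = A (i 0) (j 0) * (1 : M2) (i 1) (j 1) := by
  simp [E, tens, Fin.prod_univ_two]

lemma E1_apply (A : M2) (i j : Fin 2 → Fin 2) :
    E 1 A i j = (1 : M2) (i 0) (j 0) * A (i 1) (j 1) := by
  simp [E, tens, Fin.prod_univ_two]

def sg (i : Fin 2) : ℂ := if i = 0 then 1 else -1

def fl (i : Fin 2 → Fin 2) : Fin 2 → Fin 2 := ![1 - i 0, 1 - i 1]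

lemma JM_apply (i k : Fin 2 → Fin 2) :
    JM i k = if k = fl i then sg (i 0) * sg (i 1) else 0 := by
  have hk : k = fl i ↔ k 0 = 1 - i 0 ∧ k 1 = 1 - i 1 := by
    rw [funext_iff, Fin.forall_fin_two]; rfl
  simp only [hk, JM, tens, Matrix.of_apply, Fin.prod_univ_two]
  generalize i 0 = i0
  generalize i 1 = i1
  generalize k 0 = j0
  generalize k 1 = j1
  fin_cases i0 <;> fin_cases i1 <;> fin_cases j0 <;> fin_cases j1 <;> simp [pauliMat, sg]

lemma th_apply (X : MN 2) (i j : Fin 2 → Fin 2) :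
    th X i j = - (sg (i 0) * sg (i 1) * (sg (j 0) * sg (j 1)) * X (fl j) (fl i)) := by
  have hs : ∀ k, JM k j = JM j k := fun k => congrFun (congrFun Jt j) k
  simp only [th, Matrix.neg_apply, Matrix.mul_apply, hs, JM_apply, Matrix.transpose_apply]
  simp
  ring

lemma case_two {X : MN 2} (hX : X ∈ suSet 2) (hf : th X = X) : X ∈ kN 2 := by
  obtain ⟨h, ht⟩ := hX
  have key : X = (X ![0,0] ![1,0]).re • E 0 x + (X ![0,0] ![1,0]).im • E 0 y
      + (((X ![0,0] ![0,0]).im + (X ![0,1] ![0,1]).im) / 2) • E 0 z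
      + (X ![0,0] ![0,1]).re • E 1 x + (X ![0,0] ![0,1]).im • E 1 y
      + (((X ![0,0] ![0,0]).im - (X ![0,1] ![0,1]).im) / 2) • E 1 z := by
    have hh : ∀ i j, star (X j i) = - X i j := fun i j => by
      have := congrFun (congrFun h i) j
      simpa [Matrix.conjTranspose_apply] using this
    have ht' := fun i j => th_apply X i j
    rw [hf] at ht'
    have a1 := hh ![0, 0] ![0, 0]
    have a2 := hh ![0, 0] ![0, 1]
    have a3 := hh ![0, 0] ![1, 0]
    have a4 := hh ![0, 1] ![0, 1]
    have b1 := ht' ![0, 0] ![0, 0]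
    have b2 := ht' ![0, 0] ![0, 1]
    have b3 := ht' ![0, 0] ![1, 0]
    have b4 := ht' ![0, 0] ![1, 1]
    have b5 := ht' ![0, 1] ![0, 0]
    have b6 := ht' ![0, 1] ![0, 1]
    have b7 := ht' ![0, 1] ![1, 0]
    have b8 := ht' ![1, 0] ![0, 0]
    have b9 := ht' ![1, 0] ![0, 1]
    have b10 := ht' ![1, 1] ![0, 0]
    simp [sg, fl, Complex.ext_iff] at a1 a2 a3 a4 b1 b2 b3 b4 b5 b6 b7 b8 b9 b10
    ext i j
    have hi : i = ![i 0, i 1] := by ext k; fin_cases k <;> rfl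
    have hj : j = ![j 0, j 1] := by ext k; fin_cases k <;> rfl
    rw [hi, hj]
    generalize i 0 = i0
    generalize i 1 = i1
    generalize j 0 = j0
    generalize j 1 = j1
    fin_cases i0 <;> fin_cases i1 <;> fin_cases j0 <;> fin_cases j1 <;> apply Complex.ext <;>
      simp [E0_apply, E1_apply, pauliMat, Matrix.one_apply] <;> linarith
  rw [key]
  have m := fun (a : Fin 2) (p : Fin 4) (hp : p ≠ 0) (r : ℝ) =>
    Submodule.smul_mem (kN 2) r (E_mem a p hp)
  exact add_mem (add_mem (add_mem (add_mem (add_mem (m _ _ (by decide) _) (m _ _ (by decide) _))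
    (m _ _ (by decide) _)) (m _ _ (by decide) _)) (m _ _ (by decide) _)) (m _ _ (by decide) _)

end SymPair

/-- **`(su(2^n), su(2)^{⊗n})` is a symmetric Lie algebra pair iff `n ≤ 2`.**
There exists an involutive real Lie algebra automorphism `θ` of `su(2^n)` whose fixed-point
subalgebra is exactly `𝔨_n = su(2)^{⊗n}` if and only if `n ≤ 2`. -/
theorem symmetric_pair_iff_n_le_two (n : ℕ) (hn : 1 ≤ n) :
    (∃ θ : Matrix (Fin n → Fin 2) (Fin n → Fin 2) ℂ →
          Matrix (Fin n → Fin 2) (Fin n → Fin 2) ℂ,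
      Set.MapsTo θ (suSet n) (suSet n) ∧
      (∀ X ∈ suSet n, ∀ Y ∈ suSet n, ∀ a b : ℝ,
        θ (a • X + b • Y) = a • θ X + b • θ Y) ∧
      (∀ X ∈ suSet n, θ (θ X) = X) ∧
      (∀ X ∈ suSet n, ∀ Y ∈ suSet n,
        θ (X * Y - Y * X) = θ X * θ Y - θ Y * θ X) ∧
      {X | X ∈ suSet n ∧ θ X = X} = (kN n : Set _)) ↔ n ≤ 2 := by
  open SymPair in
  constructor
  · rintro ⟨θ, h1, h2, h3, h4, h5⟩
    by_contra h
    exact no_theta (by omega) θ h1 h2 h3 h4 h5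
  · intro h
    obtain rfl | rfl : n = 1 ∨ n = 2 := by omega
    · refine ⟨id, fun X hX => hX, fun _ _ _ _ _ _ => rfl, fun _ _ => rfl, fun _ _ _ _ => rfl, ?_⟩
      ext X
      exact ⟨fun hX => case_one hX.1, fun hX => ⟨kN_su hX, rfl⟩⟩
    · refine ⟨th, ?_, ?_, ?_, ?_, ?_⟩
      · rintro X ⟨hX, hX'⟩
        constructor
        · rw [th, conjTranspose_neg, conjTranspose_mul, conjTranspose_mul, Jh,
            show (Xᵀ)ᴴ = (Xᴴ)ᵀ from rfl, hX]
          simp [mul_assoc]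
        · rw [th, trace_neg, trace_mul_cycle, JJ, one_mul, trace_transpose, hX', neg_zero]
      · intro X _ Y _ a b
        simp [th, mul_add, add_mul, add_comm]
      · intro X _
        rw [th, th, transpose_neg, transpose_mul, transpose_mul, Jt, transpose_transpose]
        calc -(JM * -(JM * (X * JM)) * JM) = (JM * JM) * X * (JM * JM) := by noncomm_ring
          _ = X := by simp [JJ]
      · intro X _ Y _
        have e : ∀ A B : MN 2, JM * A * JM * (JM * B * JM) = JM * (A * B) * JM := fun A B => by
          calc JM * A * JM * (JM * B * JM) = JM * A * (JM * JM) * B * JM := by noncomm_ring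
            _ = _ := by rw [JJ]; noncomm_ring
        simp only [th, neg_mul_neg, e, transpose_sub, transpose_mul]
        noncomm_ring
      · ext X
        refine ⟨fun hX => case_two hX.1 hX.2, fun hX => ⟨kN_su hX, ?_⟩⟩
        have hX' : X ∈ kN 2 := hX
        clear hX
        induction hX' using Submodule.span_induction with
        | mem W hW =>
          obtain ⟨a, p, hp, rfl⟩ := (tensorSet_one _).mp hW
          exact th_E a p hp
        | zero => simp [th]
        | add X Y _ _ hX hY =>
          rw [th] at hX hY ⊢
          conv_rhs => rw [← hX, ← hY]
          simp [mul_add, add_mul, add_comm]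
        | smul c X _ hX =>
          rw [th] at hX ⊢
          conv_rhs => rw [← hX]
          simp
end
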